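/- arXiv:1610.00663 — 2 statements merged into one kernel-verified Lean document; each statement's English description precedes it below -/
import Mathlib

section
/- One-round sum leakage for the binary erasure example: Let (X1,X2) ~ DSBS(p), Y1 = X1 xor Z1 and Y2 = X2 xor Z2 with Z1, Z2 ~ Ber(p) independent of X1 and X2 respectively. Let d1 be the erasure distortion on X1 (d1(x,xhat)=0 if xhat=x, d1(x,e)=1, d1(x,1-x)=infinity) and let the distortion at agent A be zero (D2 = 0). Then the one-round sum leakage initiated at agent A satisfies L^A_{sum,1}(D1, 0) = 2 - [ (1 - D1) H(p) + (1 + D1) H(2p(1-p)) ], where H(·) is the binary entropy function. -/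
open scoped BigOperators ENNReal

noncomputable section

/-- A probability mass function on a finite type. -/
def IsPMF {α : Type*} [Fintype α] (p : α → ℝ) : Prop :=
  (∀ a, 0 ≤ p a) ∧ ∑ a, p a = 1

/-- Shannon entropy in bits (logarithm base 2). -/
def Hent2 {α : Type*} [Fintype α] (p : α → ℝ) : ℝ :=
  ∑ a, -(p a * Real.logb 2 (p a))

open Classical in
/-- Distribution (pushforward) of a random variable `f` under a joint pmf `q`. -/
def pushf {Ω α : Type*} [Fintype Ω] (q : Ω → ℝ) (f : Ω → α) : α → ℝ :=
  fun a => ∑ ω, if f ω = a then q ω else 0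

/-- Entropy (in bits) of a random variable `f` under joint pmf `q`. -/
def HRV2 {Ω α : Type*} [Fintype Ω] [Fintype α] (q : Ω → ℝ) (f : Ω → α) : ℝ :=
  Hent2 (pushf q f)

/-- Mutual information `I(f;g)` in bits under joint pmf `q`. -/
def MIrv2 {Ω α β : Type*} [Fintype Ω] [Fintype α] [Fintype β]
    (q : Ω → ℝ) (f : Ω → α) (g : Ω → β) : ℝ :=
  HRV2 q f + HRV2 q g - HRV2 q (fun ω => (f ω, g ω))

/-- Conditional entropy `H(f | g)` in bits under joint pmf `q`. -/
def condEntRV2 {Ω α β : Type*} [Fintype Ω] [Fintype α] [Fintype β]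
    (q : Ω → ℝ) (f : Ω → α) (g : Ω → β) : ℝ :=
  HRV2 q (fun ω => (f ω, g ω)) - HRV2 q g

/-- Conditional mutual information `I(f ; g | h)` in bits under joint pmf `q`. -/
def condMIrv2 {Ω α β γ : Type*} [Fintype Ω] [Fintype α] [Fintype β] [Fintype γ]
    (q : Ω → ℝ) (f : Ω → α) (g : Ω → β) (h : Ω → γ) : ℝ :=
  condEntRV2 q f h + condEntRV2 q g h - condEntRV2 q (fun ω => (f ω, g ω)) h

/-- Binary entropy function (in bits). -/
def binH (t : ℝ) : ℝ := -(t * Real.logb 2 t) - ((1 - t) * Real.logb 2 (1 - t))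

/-- Joint pmf of `(X1, Y1, X2, Y2)` where `(X1,X2) ~ DSBS(p)`, `Y1 = X1 ⊕ Z1`,
`Y2 = X2 ⊕ Z2`, `Z1, Z2 ~ Ber(p)` with `Z1, Z2` independent of `(X1, X2)` and of each
other. Coordinates: `w = (x1, y1, x2, y2)`. -/
def srcDSBS (p : ℝ) : Bool × Bool × Bool × Bool → ℝ :=
  fun w => (if w.1 = w.2.2.1 then (1 - p) / 2 else p / 2) *
    (if w.2.1 = w.1 then 1 - p else p) *
    (if w.2.2.2 = w.2.2.1 then 1 - p else p)

/-- Erasure distortion on `X1 = Bool`, with reproduction alphabet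
`Option Bool` (`none` is the erasure symbol): `0` for correct reproduction, `1` for an
erasure and `∞` for an error. -/
def dErase : Bool → Option Bool → ℝ≥0∞ :=
  fun x xh => match xh with
    | none => 1
    | some b => if b = x then 0 else ∞

/-- `L^A_{sum,1}(D1, 0)` for the DSBS/erasure example: the minimum of
`I(Y1; U_1, X2) + I(Y2; X1)` over all one-round mechanisms `P_{U1|X1}` (with arbitrary
finite output alphabet) admitting a reconstruction `X̂1 = g1(X2, U1)` of expected erasure
distortion at most `D1`. -/
def LsumA1erasure (p D1 : ℝ) : EReal :=
  sInf { L : EReal | ∃ (nU : ℕ) (κ : Bool → Fin nU → ℝ)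
    (_ : ∀ x v, 0 ≤ κ x v) (_ : ∀ x, ∑ v, κ x v = 1)
    (g1 : Bool → Fin nU → Option Bool),
    -- the joint pmf of (X1, Y1, X2, Y2, U1)
    (∑ w : Bool × Bool × Bool × Bool × Fin nU,
        ENNReal.ofReal (srcDSBS p (w.1, w.2.1, w.2.2.1, w.2.2.2.1) * κ w.1 w.2.2.2.2) *
        dErase w.1 (g1 w.2.2.1 w.2.2.2.2)) ≤ ENNReal.ofReal D1 ∧
    L = ((MIrv2 (fun w : Bool × Bool × Bool × Bool × Fin nU =>
            srcDSBS p (w.1, w.2.1, w.2.2.1, w.2.2.2.1) * κ w.1 w.2.2.2.2)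
            (fun w => w.2.1) (fun w => (w.2.2.2.2, w.2.2.1)) +
          MIrv2 (srcDSBS p) (fun w => w.2.2.2) (fun w => w.1) : ℝ) : EReal) }

/-- Homogeneous two-point entropy. -/
def phi2 (s t : ℝ) : ℝ :=
  -(s * Real.logb 2 s) - t * Real.logb 2 t + (s + t) * Real.logb 2 (s + t)

/-- Contribution of a message with likelihoods `a`, `b` to `H(Y1 | U, X2)`. -/
def fCon (p a b : ℝ) : ℝ :=
  phi2 (((1-p)^2 * a + p^2 * b)/2) (p*(1-p)*(a+b)/2) +
  phi2 ((p^2 * a + (1-p)^2 * b)/2) (p*(1-p)*(a+b)/2)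

lemma phi2_comm (s t : ℝ) : phi2 s t = phi2 t s := by
  unfold phi2; rw [add_comm s t]; ring

lemma phi2_scale (k x : ℝ) (hk : 0 ≤ k) (h0 : 0 < x) (h1 : x < 1) :
    phi2 (k * x) (k * (1 - x)) = k * binH x := by
  rcases hk.eq_or_lt with rfl | hk
  · simp [phi2]
  · have h2 : 0 < 1 - x := by linarith
    have e : k * x + k * (1 - x) = k := by ring
    unfold phi2 binH
    rw [e, Real.logb_mul hk.ne' h0.ne', Real.logb_mul hk.ne' h2.ne']
    ring

lemma gibbs_aux (s Q : ℝ) (hs : 0 ≤ s) (hQ : 0 < Q) :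
    s * Real.log Q - s * Real.log s ≤ Q - s := by
  rcases hs.eq_or_lt with rfl | hs
  · simp; exact hQ.le
  · have h := Real.log_le_sub_one_of_pos (div_pos hQ hs)
    rw [Real.log_div hQ.ne' hs.ne'] at h
    have := mul_le_mul_of_nonneg_left h hs.le
    have e : s * (Q / s - 1) = Q - s := by field_simp
    rw [e] at this; linarith

lemma gibbs (s t q : ℝ) (hs : 0 ≤ s) (ht : 0 ≤ t) (h0 : 0 < q) (h1 : q < 1) :
    phi2 s t ≤ -(s * Real.logb 2 q) - t * Real.logb 2 (1 - q) := by
  rcases (add_nonneg hs ht).eq_or_lt with h | h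
  · have a : s = 0 := by linarith
    have b : t = 0 := by linarith
    subst a b; simp [phi2]
  · have h2 : 0 < 1 - q := by linarith
    have A := gibbs_aux s (q * (s + t)) hs (by positivity)
    have B := gibbs_aux t ((1 - q) * (s + t)) ht (by positivity)
    rw [Real.log_mul h0.ne' h.ne'] at A
    rw [Real.log_mul h2.ne' h.ne'] at B
    have l2 : 0 < Real.log 2 := Real.log_pos (by norm_num)
    have : 0 ≤ (-(s * Real.log q) - t * Real.log (1 - q)
      - (-(s * Real.log s) - t * Real.log t + (s + t) * Real.log (s + t))) / Real.log 2 := by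
      apply div_nonneg _ l2.le
      nlinarith
    unfold phi2 Real.logb
    have e : (-(s * Real.log q) - t * Real.log (1 - q)
      - (-(s * Real.log s) - t * Real.log t + (s + t) * Real.log (s + t))) / Real.log 2 =
      (-(s * (Real.log q / Real.log 2)) - t * (Real.log (1 - q) / Real.log 2)) -
      (-(s * (Real.log s / Real.log 2)) - t * (Real.log t / Real.log 2)
        + (s + t) * (Real.log (s + t) / Real.log 2)) := by ring
    linarith

lemma two_bounds (p : ℝ) (hp0 : 0 < p) (hp1 : p < 1) :
    0 < 2 * p * (1 - p) ∧ 2 * p * (1 - p) < 1 := by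
  constructor
  · have : 0 < 1 - p := by linarith
    positivity
  · nlinarith [sq_nonneg (1 - 2 * p)]

lemma fCon_le (p a b : ℝ) (hp0 : 0 < p) (hp1 : p < 1) (ha : 0 ≤ a) (hb : 0 ≤ b) :
    fCon p a b ≤ (a + b) / 2 * binH (2 * p * (1 - p)) := by
  obtain ⟨h0, h1⟩ := two_bounds p hp0 hp1
  have hq : 0 < 1 - p := by linarith
  have A := gibbs (((1-p)^2 * a + p^2 * b)/2) (p*(1-p)*(a+b)/2) (1 - 2 * p * (1 - p))
    (by positivity) (by positivity) (by linarith) (by linarith)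
  have B := gibbs ((p^2 * a + (1-p)^2 * b)/2) (p*(1-p)*(a+b)/2) (1 - 2 * p * (1 - p))
    (by positivity) (by positivity) (by linarith) (by linarith)
  have e : 1 - (1 - 2 * p * (1 - p)) = 2 * p * (1 - p) := by ring
  rw [e] at A B
  unfold fCon binH
  refine (add_le_add A B).trans (le_of_eq ?_)
  ring

lemma fCon_left (p a : ℝ) (hp0 : 0 < p) (hp1 : p < 1) (ha : 0 ≤ a) :
    fCon p a 0 = a / 2 * binH p := by
  have hq : 0 < 1 - p := by linarith
  have A := phi2_scale ((1-p) * a / 2) p (by positivity) hp0 hp1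
  have B := phi2_scale (p * a / 2) p (by positivity) hp0 hp1
  unfold fCon
  rw [phi2_comm]
  have e1 : p*(1-p)*(a+0)/2 = (1-p) * a / 2 * p := by ring
  have e2 : ((1-p)^2 * a + p^2 * 0)/2 = (1-p) * a / 2 * (1 - p) := by ring
  have e3 : p*(1-p)*(a+0)/2 = p * a / 2 * (1-p) := by ring
  have e4 : (p^2 * a + (1-p)^2 * 0)/2 = p * a / 2 * p := by ring
  rw [e2, e4]
  nth_rewrite 1 [e1]
  rw [e3, A, B]; ring

lemma fCon_comm (p a b : ℝ) : fCon p a b = fCon p b a := by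
  unfold fCon
  rw [add_comm, add_comm a b, add_comm (p^2 * a), add_comm ((1-p)^2 * a)]

lemma fCon_right (p a : ℝ) (hp0 : 0 < p) (hp1 : p < 1) (ha : 0 ≤ a) :
    fCon p 0 a = a / 2 * binH p := by
  rw [fCon_comm, fCon_left p a hp0 hp1 ha]

lemma fCon_diag (p a : ℝ) (hp0 : 0 < p) (hp1 : p < 1) (ha : 0 ≤ a) :
    fCon p a a = a * binH (2 * p * (1 - p)) := by
  obtain ⟨h0, h1⟩ := two_bounds p hp0 hp1
  have A := phi2_scale (a / 2) (2 * p * (1 - p)) (by positivity) h0 h1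
  have e1 : p*(1-p)*(a+a)/2 = a / 2 * (2 * p * (1 - p)) := by ring
  have e2 : ((1-p)^2 * a + p^2 * a)/2 = a / 2 * (1 - 2 * p * (1 - p)) := by ring
  have e3 : (p^2 * a + (1-p)^2 * a)/2 = a / 2 * (1 - 2 * p * (1 - p)) := by ring
  unfold fCon
  rw [e1, e2, e3, phi2_comm, A]; ring

lemma binH_le (p : ℝ) (hp0 : 0 < p) (hp1 : p < 1) : binH p ≤ binH (2 * p * (1 - p)) := by
  have A := fCon_le p 1 0 hp0 hp1 (by norm_num) le_rfl
  rw [fCon_left p 1 hp0 hp1 (by norm_num)] at A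
  linarith

lemma logb_half : Real.logb 2 (1/2) = -1 := by
  rw [one_div, Real.logb_inv, Real.logb_self_eq_one (by norm_num)]

lemma MI_second (p : ℝ) (hp0 : 0 < p) (hp1 : p < 1) :
    MIrv2 (srcDSBS p) (fun w => w.2.2.2) (fun w => w.1) = 1 - binH (2 * p * (1 - p)) := by
  obtain ⟨h0, h1⟩ := two_bounds p hp0 hp1
  have A : pushf (srcDSBS p) (fun w => w.2.2.2) = fun _ => 1/2 := by
    funext b
    cases b <;> simp [pushf, srcDSBS, Fintype.sum_prod_type] <;> ring
  have B : pushf (srcDSBS p) (fun w => w.1) = fun _ => 1/2 := by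
    funext b
    cases b <;> simp [pushf, srcDSBS, Fintype.sum_prod_type] <;> ring
  have C : pushf (srcDSBS p) (fun w => (w.2.2.2, w.1)) =
      fun w => 1/2 * (if w.1 = w.2 then 1 - 2 * p * (1 - p) else 2 * p * (1 - p)) := by
    funext ⟨b, c⟩
    cases b <;> cases c <;> simp [pushf, srcDSBS, Fintype.sum_prod_type] <;> ring
  unfold MIrv2 HRV2 Hent2
  rw [A, B, C]
  have h2 : 0 < 1 - 2 * p * (1 - p) := by linarith
  simp only [Fintype.sum_prod_type, Fintype.sum_bool, if_true, if_false, logb_half,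
    reduceCtorEq]
  rw [Real.logb_mul (by norm_num) h2.ne', Real.logb_mul (by norm_num) h0.ne', logb_half]
  unfold binH
  ring

/-- joint pmf -/
def jq (p : ℝ) {n : ℕ} (κ : Bool → Fin n → ℝ) : Bool × Bool × Bool × Bool × Fin n → ℝ :=
  fun w => srcDSBS p (w.1, w.2.1, w.2.2.1, w.2.2.2.1) * κ w.1 w.2.2.2.2

lemma MI_first (p : ℝ) {n : ℕ} (κ : Bool → Fin n → ℝ) (hκ : ∀ x, ∑ v, κ x v = 1) :
    MIrv2 (jq p κ) (fun w => w.2.1) (fun w => (w.2.2.2.2, w.2.2.1)) =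
      1 - ∑ v, fCon p (κ false v) (κ true v) := by
  have A : pushf (jq p κ) (fun w => w.2.1) = fun _ => 1/2 := by
    funext b
    cases b <;> simp [pushf, jq, srcDSBS, Fintype.sum_prod_type, ← Finset.mul_sum, hκ] <;> ring
  have B : pushf (jq p κ) (fun w => (w.2.2.2.2, w.2.2.1)) =
      fun w => if w.2 then (p * κ false w.1 + (1-p) * κ true w.1)/2
        else ((1-p) * κ false w.1 + p * κ true w.1)/2 := by
    funext ⟨v, b⟩
    cases b <;> simp [pushf, jq, srcDSBS, Fintype.sum_prod_type] <;> ring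
  have C : pushf (jq p κ) (fun w => (w.2.1, (w.2.2.2.2, w.2.2.1))) =
      fun w => if w.1 = w.2.2 then
        (if w.2.2 then (p^2 * κ false w.2.1 + (1-p)^2 * κ true w.2.1)/2
          else ((1-p)^2 * κ false w.2.1 + p^2 * κ true w.2.1)/2)
        else p*(1-p)*(κ false w.2.1 + κ true w.2.1)/2 := by
    funext ⟨y, v, b⟩
    cases b <;> cases y <;> simp [pushf, jq, srcDSBS, Fintype.sum_prod_type] <;> ring
  unfold MIrv2 HRV2 Hent2
  rw [A, B, C]
  simp only [Fintype.sum_prod_type, Fintype.sum_bool, if_true, if_false, logb_half,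
    reduceCtorEq, Bool.false_eq_true]
  have : ∀ v, fCon p (κ false v) (κ true v) =
    -((fun a b => (-(a * Real.logb 2 a) + -(b * Real.logb 2 b)))
      ((p * κ false v + (1-p) * κ true v)/2) (((1-p) * κ false v + p * κ true v)/2)) +
    ((fun a b => (-(a * Real.logb 2 a) + -(b * Real.logb 2 b)))
      ((p^2 * κ false v + (1-p)^2 * κ true v)/2) (p*(1-p)*(κ false v + κ true v)/2)) +
    ((fun a b => (-(a * Real.logb 2 a) + -(b * Real.logb 2 b)))
       (p*(1-p)*(κ false v + κ true v)/2) (((1-p)^2 * κ false v + p^2 * κ true v)/2)) := by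
    intro v
    unfold fCon phi2
    have e1 : ((1-p)^2 * κ false v + p^2 * κ true v)/2 + p*(1-p)*(κ false v + κ true v)/2 =
      ((1-p) * κ false v + p * κ true v)/2 := by ring
    have e2 : (p^2 * κ false v + (1-p)^2 * κ true v)/2 + p*(1-p)*(κ false v + κ true v)/2 =
      (p * κ false v + (1-p) * κ true v)/2 := by ring
    rw [e1, e2]
    ring
  simp only [this, Finset.sum_add_distrib, Finset.sum_neg_distrib]
  ring

lemma sum_jq (p : ℝ) {n : ℕ} (κ : Bool → Fin n → ℝ) (c : Fin n → ℝ) :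
    ∑ w, jq p κ w * c w.2.2.2.2 = ∑ v, (κ false v + κ true v) / 2 * c v := by
  simp only [Fintype.sum_prod_type, Fintype.sum_bool, jq, srcDSBS, ← Finset.sum_add_distrib]
  refine Finset.sum_congr rfl fun v _ => ?_
  simp
  ring

lemma jq_nonneg (p : ℝ) (hp0 : 0 < p) (hp1 : p < 1) {n : ℕ} (κ : Bool → Fin n → ℝ)
    (h : ∀ x v, 0 ≤ κ x v) (w) : 0 ≤ jq p κ w := by
  have hq : 0 < 1 - p := by linarith
  unfold jq srcDSBS
  refine mul_nonneg (mul_nonneg (mul_nonneg ?_ ?_) ?_) (h _ _) <;> split_ifs <;> positivity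

lemma jq_pos (p : ℝ) (hp0 : 0 < p) (hp1 : p < 1) {n : ℕ} (κ : Bool → Fin n → ℝ)
    (w) (h : 0 < κ w.1 w.2.2.2.2) : 0 < jq p κ w := by
  have hq : 0 < 1 - p := by linarith
  unfold jq srcDSBS
  refine mul_pos (mul_pos (mul_pos ?_ ?_) ?_) h <;> split_ifs <;> positivity

open Classical in
lemma amb_le (p D1 : ℝ) (hp0 : 0 < p) (hp1 : p < 1) (hD0 : 0 ≤ D1) {n : ℕ}
    (κ : Bool → Fin n → ℝ) (h : ∀ x v, 0 ≤ κ x v) (g1 : Bool → Fin n → Option Bool)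
    (hd : (∑ w, ENNReal.ofReal (jq p κ w) * dErase w.1 (g1 w.2.2.1 w.2.2.2.2))
      ≤ ENNReal.ofReal D1) :
    ∑ v, (κ false v + κ true v) / 2 * (if 0 < κ false v ∧ 0 < κ true v then 1 else 0) ≤ D1 := by
  rw [← sum_jq p κ (fun v => if 0 < κ false v ∧ 0 < κ true v then 1 else 0),
    ← ENNReal.ofReal_le_ofReal_iff hD0, ENNReal.ofReal_sum_of_nonneg]
  · refine le_trans (Finset.sum_le_sum fun w _ => ?_) hd
    split_ifs with hc
    · have : g1 w.2.2.1 w.2.2.2.2 = none := by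
        by_contra hne
        obtain ⟨b, hb⟩ := Option.ne_none_iff_exists'.mp hne
        let w' : Bool × Bool × Bool × Bool × Fin n := (!b, w.2)
        have hpos : 0 < jq p κ w' := by
          apply jq_pos p hp0 hp1
          cases b
          · exact hc.2
          · exact hc.1
        have hlt := (ENNReal.sum_lt_top.mp (lt_of_le_of_lt hd ENNReal.ofReal_lt_top)) w'
          (Finset.mem_univ _)
        have e : dErase w'.1 (g1 w'.2.2.1 w'.2.2.2.2) = ⊤ := by
          change dErase (!b) (g1 w.2.2.1 w.2.2.2.2) = ⊤
          rw [hb]; simp [dErase]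
        rw [e, ENNReal.mul_top (by simpa using hpos)] at hlt
        exact lt_irrefl _ hlt
      rw [this]; simp [dErase]
    · simp
  · intro w _
    apply mul_nonneg (jq_nonneg p hp0 hp1 κ h w)
    split_ifs <;> norm_num

theorem one_round_sum_leakage_erasure
    (p D1 : ℝ) (hp0 : 0 < p) (hp1 : p < 1) (hD0 : 0 ≤ D1) (hD1 : D1 ≤ 1) :
    LsumA1erasure p D1 =
      ((2 - ((1 - D1) * binH p + (1 + D1) * binH (2 * p * (1 - p))) : ℝ) : EReal) := by
  classical
  apply le_antisymm
  · apply sInf_le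
    let κ : Bool → Fin 3 → ℝ := fun x =>
      ![D1, if x then 1 - D1 else 0, if x then 0 else 1 - D1]
    have hκ : ∀ x, ∑ v, κ x v = 1 := by
      intro x; cases x <;> simp [κ, Fin.sum_univ_three]
    have hD1' : 0 ≤ 1 - D1 := by linarith
    have hn : ∀ x v, 0 ≤ κ x v := by
      intro x v; fin_cases v <;> cases x <;> simp [κ, hD0, hD1]
    refine ⟨3, κ, hn, hκ, fun _ => ![none, some true, some false], ?_, ?_⟩
    · have e := sum_jq p κ ![1, 0, 0]
      have e' : ∑ v, (κ false v + κ true v) / 2 * (![1, 0, 0] : Fin 3 → ℝ) v = D1 := by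
        simp [κ, Fin.sum_univ_three]
      rw [e'] at e
      rw [← e, ENNReal.ofReal_sum_of_nonneg]
      · refine Finset.sum_le_sum fun w _ => ?_
        obtain ⟨x1, y1, x2, y2, v⟩ := w
        fin_cases v <;> cases x1 <;> simp [dErase, jq, κ]
      · intro w _
        apply mul_nonneg (jq_nonneg p hp0 hp1 κ hn w)
        generalize w.2.2.2.2 = v
        fin_cases v <;> simp
    · congr 1
      have A := MI_first p κ hκ
      unfold jq at A
      rw [A, MI_second p hp0 hp1, Fin.sum_univ_three]
      have e0 : fCon p (κ false 0) (κ true 0) = D1 * binH (2 * p * (1 - p)) :=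
        fCon_diag p D1 hp0 hp1 hD0
      have e1 : fCon p (κ false 1) (κ true 1) = (1 - D1) / 2 * binH p := by
        simpa [κ] using fCon_right p (1 - D1) hp0 hp1 hD1'
      have e2 : fCon p (κ false 2) (κ true 2) = (1 - D1) / 2 * binH p := by
        simpa [κ] using fCon_left p (1 - D1) hp0 hp1 hD1'
      rw [e0, e1, e2]; ring
  · apply le_sInf
    rintro L ⟨n, κ, hn, hκ, g1, hd, rfl⟩
    rw [EReal.coe_le_coe_iff]
    have A := MI_first p κ hκ
    unfold jq at A
    rw [A, MI_second p hp0 hp1]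
    have hm := amb_le p D1 hp0 hp1 hD0 κ hn g1 hd
    have hle := binH_le p hp0 hp1
    have key : ∀ v, fCon p (κ false v) (κ true v) ≤ (κ false v + κ true v) / 2 * binH p +
        (κ false v + κ true v) / 2 * (if 0 < κ false v ∧ 0 < κ true v then 1 else 0) *
          (binH (2 * p * (1 - p)) - binH p) := by
      intro v
      split_ifs with hc
      · have := fCon_le p _ _ hp0 hp1 (hn false v) (hn true v)
        linarith
      · rcases (hn false v).eq_or_lt with h0 | h0
        · rw [← h0, fCon_right p _ hp0 hp1 (hn true v)]; simp
        · have h1 : κ true v = 0 := le_antisymm (not_lt.mp fun h => hc ⟨h0, h⟩) (hn true v)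
          rw [h1, fCon_left p _ hp0 hp1 (hn false v)]; simp
    have S := Finset.sum_le_sum (s := Finset.univ) fun v _ => key v
    rw [Finset.sum_add_distrib, ← Finset.sum_mul, ← Finset.sum_mul, ← Finset.sum_div,
      Finset.sum_add_distrib, hκ, hκ] at S
    have T := mul_le_mul_of_nonneg_right hm (sub_nonneg.mpr hle)
    linarith

end
end

section
/- Interaction strictly reduces leakage in the binary erasure example: Let (X1,X2) ~ DSBS(p) with p = 0.03, Y1 = X1 xor Z1, Y2 = X2 xor Z2 with Z1, Z2 ~ Ber(p) independent of X1, X2 respectively, erasure distortion d1 on X1 and zero distortion at agent A. Consider the two-round mechanism initiated at agent B given by: U1 is the output of a binary symmetric channel with crossover probability alpha = 0.35 applied to X2; U2 is generated from (X1,U1) by P(U2=0|X1=0,U1=0)=1-beta, P(U2=e|X1=0,U1=0)=beta, P(U2=e|X1=1,U1=0)=1, P(U2=e|X1=0,U1=1)=1, P(U2=e|X1=1,U1=1)=beta, P(U2=1|X1=1,U1=1)=1-beta with beta = 0.55; and hatX1 = U2. Let D1 = E[d1(X1, hatX1)] be its distortion. Then the achieved two-round sum leakage satisfies I(Y2; U1,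 X1) + I(Y1; U2 | U1, X2) < L^A_{sum,1}(D1, 0) = 2 - [ (1 - D1) H(p) + (1 + D1) H(2p(1-p)) ], i.e., the two-round scheme leaks strictly less than the optimal one-round scheme at the same distortion. -/
open scoped BigOperators ENNReal

noncomputable section

/-- Round-1 mechanism of the two-round scheme: `U1` is the output of a `BSC(α)`
applied to `X2`. -/
def κ1BSC (α : ℝ) : Bool → Bool → ℝ :=
  fun x2 u1 => if u1 = x2 then 1 - α else α

/-- Round-2 mechanism of the two-round scheme: the conditional law `P_{U2 | X1, U1}`
of Table I (the erasure symbol `e` is `none`). -/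
def κ2Table (β : ℝ) : Bool → Bool → Option Bool → ℝ :=
  fun x1 u1 u2 =>
    match x1, u1, u2 with
    | false, false, some false => 1 - β
    | false, false, none => β
    | false, false, some true => 0
    | true, false, none => 1
    | true, false, _ => 0
    | false, true, none => 1
    | false, true, _ => 0
    | true, true, none => β
    | true, true, some true => 1 - β
    | true, true, some false => 0

/-- Joint pmf of `(X1, Y1, X2, Y2, U1, U2)` for the two-round mechanism initiated at
agent B (`U1` from `X2` via `BSC(α)`, then `U2` from `(X1, U1)` via Table I). -/
def joint2round (p α β : ℝ) : Bool × Bool × Bool × Bool × Bool × Option Bool → ℝ :=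
  fun w => srcDSBS p (w.1, w.2.1, w.2.2.1, w.2.2.2.1) *
    κ1BSC α w.2.2.1 w.2.2.2.2.1 * κ2Table β w.1 w.2.2.2.2.1 w.2.2.2.2.2

lemma gibbs1 {m c : ℝ} (hm : 0 ≤ m) (hc : 0 < c) :
    m * Real.log c + m - c ≤ m * Real.log m := by
  rcases hm.eq_or_lt with h | h
  · subst h; simp; exact hc.le
  · have h1 := Real.log_le_sub_one_of_pos (div_pos hc h)
    rw [Real.log_div hc.ne' h.ne'] at h1
    have h2 := mul_le_mul_of_nonneg_left h1 hm
    have h3 : m * (c / m - 1) = c - m := by field_simp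
    nlinarith

lemma gibbs2 {m0 m1 r : ℝ} (h0 : 0 ≤ m0) (h1 : 0 ≤ m1) (hr : 0 < r) (hr1 : r < 1) :
    m0 * Real.logb 2 (1 - r) + m1 * Real.logb 2 r + (m0 + m1) * Real.logb 2 (m0 + m1) ≤
      m0 * Real.logb 2 m0 + m1 * Real.logb 2 m1 := by
  have hl : 0 < Real.log 2 := Real.log_pos (by norm_num)
  simp only [Real.logb, ← mul_div_assoc, ← add_div]
  rw [div_le_div_iff_of_pos_right hl]
  rcases (add_nonneg h0 h1).eq_or_lt with h | h
  · have : m0 = 0 := by linarith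
    have : m1 = 0 := by linarith
    subst_vars; simp
  · have hr' : 0 < 1 - r := by linarith
    have a := gibbs1 h0 (mul_pos h hr')
    have b := gibbs1 h1 (mul_pos h hr)
    rw [Real.log_mul h.ne' hr'.ne'] at a
    rw [Real.log_mul h.ne' hr.ne'] at b
    nlinarith

/-- `x log₂ x` -/
def xl (x : ℝ) : ℝ := x * Real.logb 2 x

lemma xl_mul {a b : ℝ} (ha : 0 ≤ a) (hb : 0 < b) : xl (a * b) = a * xl b + b * xl a := by
  unfold xl
  rcases ha.eq_or_lt with h | h
  · subst h; simp
  · rw [Real.logb_mul h.ne' hb.ne']; ring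

lemma xl_zero : xl 0 = 0 := by simp [xl]

/-- contribution of one letter `u` to `H(Y1 | U, X2)`. -/
def Fc (p a b : ℝ) : ℝ :=
  (xl ((1 - p) / 2 * a + p / 2 * b) + xl (p / 2 * a + (1 - p) / 2 * b)) -
  (xl ((1 - p) / 2 * (1 - p) * a + p / 2 * p * b) + xl ((1 - p) / 2 * p * a + p / 2 * (1 - p) * b)
   + xl (p / 2 * (1 - p) * a + (1 - p) / 2 * p * b) + xl (p / 2 * p * a + (1 - p) / 2 * (1 - p) * b))

lemma Fc_le {p a b : ℝ} (hp : 0 < p) (hp1 : p < 1) (ha : 0 ≤ a) (hb : 0 ≤ b) :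
    Fc p a b ≤ (a + b) / 2 * binH (2 * p * (1 - p)) := by
  have hq : 0 < 1 - p := by linarith
  have hr : 0 < 2 * p * (1 - p) := by positivity
  have hr1 : 2 * p * (1 - p) < 1 := by nlinarith [sq_nonneg (p - 1/2)]
  have A := gibbs2 (m0 := (1 - p) / 2 * (1 - p) * a + p / 2 * p * b)
    (m1 := (1 - p) / 2 * p * a + p / 2 * (1 - p) * b) (by positivity) (by positivity) hr hr1
  have B := gibbs2 (m0 := p / 2 * p * a + (1 - p) / 2 * (1 - p) * b)
    (m1 := p / 2 * (1 - p) * a + (1 - p) / 2 * p * b) (by positivity) (by positivity) hr hr1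
  have e1 : (1 - p) / 2 * (1 - p) * a + p / 2 * p * b + ((1 - p) / 2 * p * a + p / 2 * (1 - p) * b)
    = (1 - p) / 2 * a + p / 2 * b := by ring
  have e2 : p / 2 * p * a + (1 - p) / 2 * (1 - p) * b + (p / 2 * (1 - p) * a + (1 - p) / 2 * p * b)
    = p / 2 * a + (1 - p) / 2 * b := by ring
  rw [e1] at A
  rw [e2] at B
  unfold Fc xl binH
  linarith

lemma Fc_left {p a : ℝ} (hp : 0 < p) (hp1 : p < 1) (ha : 0 ≤ a) :
    Fc p a 0 = a / 2 * binH p := by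
  have hq : 0 < 1 - p := by linarith
  unfold Fc
  simp only [mul_zero, add_zero]
  have e1 : (1 - p) / 2 * a = (a / 2) * (1 - p) := by ring
  have e2 : p / 2 * a = (a / 2) * p := by ring
  have e3 : (1 - p) / 2 * (1 - p) * a = (a / 2) * ((1 - p) * (1 - p)) := by ring
  have e4 : (1 - p) / 2 * p * a = (a / 2) * (p * (1 - p)) := by ring
  have e5 : p / 2 * (1 - p) * a = (a / 2) * (p * (1 - p)) := by ring
  have e6 : p / 2 * p * a = (a / 2) * (p * p) := by ring
  have ha2 : 0 ≤ a / 2 := by positivity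
  rw [e3, e4, e5, e6, e1, e2, xl_mul ha2 (by positivity), xl_mul ha2 (by positivity),
    xl_mul ha2 (by positivity), xl_mul ha2 (by positivity), xl_mul ha2 (by positivity),
    xl_mul hq.le hq, xl_mul hp.le hq, xl_mul hp.le hp]
  unfold binH xl
  ring

lemma Fc_symm (p a b : ℝ) : Fc p a b = Fc p b a := by
  unfold Fc
  rw [add_comm (p / 2 * (1 - p) * a), add_comm (p / 2 * p * a), add_comm (p / 2 * a),
    add_comm ((1 - p) / 2 * (1 - p) * a), add_comm ((1 - p) / 2 * p * a),
    add_comm ((1 - p) / 2 * a)]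
  ring

lemma Fc_diag {p a : ℝ} (hp : 0 < p) (hp1 : p < 1) (ha : 0 ≤ a) :
    Fc p a a = a * binH (2 * p * (1 - p)) := by
  have hq : 0 < 1 - p := by linarith
  have hr : 0 < 2 * p * (1 - p) := by positivity
  have hr1 : 0 < 1 - 2 * p * (1 - p) := by nlinarith [sq_nonneg (p - 1/2)]
  unfold Fc
  have e1 : (1 - p) / 2 * a + p / 2 * a = a / 2 := by ring
  have e2 : p / 2 * a + (1 - p) / 2 * a = a / 2 := by ring
  have e3 : (1 - p) / 2 * (1 - p) * a + p / 2 * p * a = (a / 2) * (1 - 2 * p * (1 - p)) := by ring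
  have e4 : (1 - p) / 2 * p * a + p / 2 * (1 - p) * a = (a / 2) * (2 * p * (1 - p)) := by ring
  have e5 : p / 2 * (1 - p) * a + (1 - p) / 2 * p * a = (a / 2) * (2 * p * (1 - p)) := by ring
  have e6 : p / 2 * p * a + (1 - p) / 2 * (1 - p) * a = (a / 2) * (1 - 2 * p * (1 - p)) := by ring
  have ha2 : 0 ≤ a / 2 := by positivity
  rw [e1, e2, e3, e4, e5, e6, xl_mul ha2 hr1, xl_mul ha2 hr]
  unfold binH xl
  ring

lemma Hent2_eq {α : Type*} [Fintype α] (p : α → ℝ) : Hent2 p = ∑ a, -xl (p a) := rfl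

lemma xl_half : xl (1 / 2) = -1 / 2 := by
  unfold xl
  rw [one_div, Real.logb_inv, Real.logb_self_eq_one (by norm_num)]; norm_num

/-- joint pmf of the one round scheme -/
def j1 (p : ℝ) {n : ℕ} (κ : Bool → Fin n → ℝ) : Bool × Bool × Bool × Bool × Fin n → ℝ :=
  fun w => srcDSBS p (w.1, w.2.1, w.2.2.1, w.2.2.2.1) * κ w.1 w.2.2.2.2

lemma j1_Y1 (p : ℝ) {n : ℕ} (κ : Bool → Fin n → ℝ) (h : ∀ x, ∑ v, κ x v = 1) (y : Bool) :
    pushf (j1 p κ) (fun w => w.2.1) y = 1 / 2 := by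
  unfold pushf j1 srcDSBS
  cases y <;> simp [Fintype.sum_prod_type, ← Finset.mul_sum, h] <;> ring

lemma j1_UX2 (p : ℝ) {n : ℕ} (κ : Bool → Fin n → ℝ) (u : Fin n) (x : Bool) :
    pushf (j1 p κ) (fun w => (w.2.2.2.2, w.2.2.1)) (u, x) =
      (if x = false then (1 - p) / 2 * κ false u + p / 2 * κ true u else
        p / 2 * κ false u + (1 - p) / 2 * κ true u) := by
  unfold pushf j1 srcDSBS
  cases x <;> simp [Fintype.sum_prod_type] <;> ring

lemma j1_Y1UX2 (p : ℝ) {n : ℕ} (κ : Bool → Fin n → ℝ) (y : Bool) (u : Fin n) (x : Bool) :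
    pushf (j1 p κ) (fun w => (w.2.1, (w.2.2.2.2, w.2.2.1))) (y, (u, x)) =
      (if x = false then (if y = false then (1 - p) / 2 * (1 - p) * κ false u + p / 2 * p * κ true u
        else (1 - p) / 2 * p * κ false u + p / 2 * (1 - p) * κ true u) else
        (if y = false then p / 2 * (1 - p) * κ false u + (1 - p) / 2 * p * κ true u
        else p / 2 * p * κ false u + (1 - p) / 2 * (1 - p) * κ true u)) := by
  unfold pushf j1 srcDSBS
  cases x <;> cases y <;> simp [Fintype.sum_prod_type] <;> ring

lemma j1_MI (p : ℝ) {n : ℕ} (κ : Bool → Fin n → ℝ) (h : ∀ x, ∑ v, κ x v = 1) :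
    MIrv2 (j1 p κ) (fun w => w.2.1) (fun w => (w.2.2.2.2, w.2.2.1)) =
      1 - ∑ u, Fc p (κ false u) (κ true u) := by
  unfold MIrv2 HRV2
  simp only [Hent2_eq, Fintype.sum_prod_type, j1_Y1UX2, j1_UX2, j1_Y1 p κ h, xl_half,
    Fintype.sum_bool, Fc]
  simp only [Finset.sum_add_distrib, Finset.sum_sub_distrib, Finset.sum_neg_distrib]
  simp
  ring

lemma src_MI {p : ℝ} (hp : 0 < p) (hp1 : p < 1) :
    MIrv2 (srcDSBS p) (fun w => w.2.2.2) (fun w => w.1) = 1 - binH (2 * p * (1 - p)) := by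
  have hq : 0 < 1 - p := by linarith
  have hr : 0 < 2 * p * (1 - p) := by positivity
  have hr1 : 0 < 1 - 2 * p * (1 - p) := by nlinarith [sq_nonneg (p - 1/2)]
  have a1 : ∀ y, pushf (srcDSBS p) (fun w => w.2.2.2) y = 1 / 2 := by
    intro y
    unfold pushf srcDSBS
    cases y <;> simp [Fintype.sum_prod_type] <;> ring
  have a2 : ∀ y, pushf (srcDSBS p) (fun w => w.1) y = 1 / 2 := by
    intro y
    unfold pushf srcDSBS
    cases y <;> simp [Fintype.sum_prod_type] <;> ring
  have a3 : ∀ y x, pushf (srcDSBS p) (fun w => (w.2.2.2, w.1)) (y, x) =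
      1 / 2 * (if x = y then 1 - 2 * p * (1 - p) else 2 * p * (1 - p)) := by
    intro y x
    unfold pushf srcDSBS
    cases y <;> cases x <;> simp [Fintype.sum_prod_type] <;> ring
  unfold MIrv2 HRV2
  simp only [Hent2_eq, Fintype.sum_prod_type, a1, a2, a3, xl_half, Fintype.sum_bool]
  simp only [if_true, Bool.false_eq_true, Bool.true_eq_false, if_false]
  rw [xl_mul (by norm_num) hr1, xl_mul (by norm_num) hr, xl_half]
  unfold binH xl
  ring

lemma j1_sum (p : ℝ) {n : ℕ} (κ : Bool → Fin n → ℝ) (φ : Fin n → ℝ) :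
    ∑ w, j1 p κ w * φ w.2.2.2.2 = ∑ u, φ u * ((κ false u + κ true u) / 2) := by
  unfold j1 srcDSBS
  simp only [Fintype.sum_prod_type, Fintype.sum_bool, ← Finset.sum_add_distrib]
  refine Finset.sum_congr rfl fun u _ => ?_
  simp
  ring

lemma j1_nonneg {p : ℝ} (hp : 0 < p) (hp1 : p < 1) {n : ℕ} (κ : Bool → Fin n → ℝ)
    (h0 : ∀ x v, 0 ≤ κ x v) (w) : 0 ≤ j1 p κ w := by
  have hq : 0 < 1 - p := by linarith
  have := h0 w.1 w.2.2.2.2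
  unfold j1 srcDSBS
  refine mul_nonneg (mul_nonneg (mul_nonneg ?_ ?_) ?_) this <;> dsimp only <;> split_ifs <;> positivity

lemma src_pos {p : ℝ} (hp : 0 < p) (hp1 : p < 1) (w) : 0 < srcDSBS p w := by
  have hq : 0 < 1 - p := by linarith
  unfold srcDSBS
  refine mul_pos (mul_pos ?_ ?_) ?_ <;> split_ifs <;> positivity

lemma lower {p D : ℝ} (hp : 0 < p) (hp1 : p < 1) (hD : 0 ≤ D) {n : ℕ} (κ : Bool → Fin n → ℝ)
    (h0 : ∀ x v, 0 ≤ κ x v) (h : ∀ x, ∑ v, κ x v = 1) (g : Bool → Fin n → Option Bool)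
    (hg : ∑ w, ENNReal.ofReal (j1 p κ w) * dErase w.1 (g w.2.2.1 w.2.2.2.2) ≤ ENNReal.ofReal D) :
    ∑ u, Fc p (κ false u) (κ true u) ≤ (1 - D) * binH p + D * binH (2 * p * (1 - p)) := by
  classical
  set φ : Fin n → ℝ := fun u => if 0 < κ false u ∧ 0 < κ true u then 1 else 0 with hφ
  have hle : binH p ≤ binH (2 * p * (1 - p)) := by
    have a := Fc_le hp hp1 (a := 2) (b := 0) (by norm_num) le_rfl
    rw [Fc_left hp hp1 (by norm_num)] at a
    linarith
  have hs : ∑ u, (κ false u + κ true u) / 2 = 1 := by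
    rw [← Finset.sum_div, Finset.sum_add_distrib, h, h]; norm_num
  have key : ∑ u, φ u * ((κ false u + κ true u) / 2) ≤ D := by
    rw [← j1_sum p κ φ, ← ENNReal.ofReal_le_ofReal_iff hD,
      ENNReal.ofReal_sum_of_nonneg]
    · refine le_trans (Finset.sum_le_sum fun w _ => ?_) hg
      by_cases hw : 0 < κ false w.2.2.2.2 ∧ 0 < κ true w.2.2.2.2
      · have hn : g w.2.2.1 w.2.2.2.2 = none := by
          rcases hgg : g w.2.2.1 w.2.2.2.2 with _ | c
          · rfl
          · exfalso
            have h1 := (Finset.single_le_sum (f := fun w => ENNReal.ofReal (j1 p κ w) *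
              dErase w.1 (g w.2.2.1 w.2.2.2.2)) (fun _ _ => zero_le)
              (Finset.mem_univ (!c, w.2.1, w.2.2.1, w.2.2.2.1, w.2.2.2.2))).trans hg
            have hpos : 0 < j1 p κ (!c, w.2.1, w.2.2.1, w.2.2.2.1, w.2.2.2.2) := by
              refine mul_pos (src_pos hp hp1 _) ?_
              cases c
              · exact hw.2
              · exact hw.1
            simp only [hgg, dErase] at h1
            rw [if_neg (by cases c <;> simp), ENNReal.mul_top (by simpa using hpos)] at h1
            simp at h1
        rw [hn]
        simp [hφ, hw, dErase]
      · simp [hφ, hw]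
    · intro w _
      refine mul_nonneg (j1_nonneg hp hp1 κ h0 w) ?_
      simp only [hφ]; split_ifs <;> norm_num
  calc ∑ u, Fc p (κ false u) (κ true u)
      ≤ ∑ u, ((κ false u + κ true u) / 2 * binH p +
          (φ u * ((κ false u + κ true u) / 2)) * (binH (2 * p * (1 - p)) - binH p)) := by
        refine Finset.sum_le_sum fun u _ => ?_
        by_cases hw : 0 < κ false u ∧ 0 < κ true u
        · have := Fc_le hp hp1 (h0 false u) (h0 true u)
          simp only [hφ, if_pos hw]
          linarith
        · simp only [hφ, if_neg hw]
          rw [not_and_or] at hw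
          rcases hw with hw | hw
          · have e : κ false u = 0 := le_antisymm (not_lt.mp hw) (h0 _ _)
            rw [e, Fc_symm, Fc_left hp hp1 (h0 _ _)]
            apply le_of_eq; ring
          · have e : κ true u = 0 := le_antisymm (not_lt.mp hw) (h0 _ _)
            rw [e, Fc_left hp hp1 (h0 _ _)]
            apply le_of_eq; ring
    _ = binH p + (∑ u, φ u * ((κ false u + κ true u) / 2)) * (binH (2 * p * (1 - p)) - binH p) := by
        rw [Finset.sum_add_distrib, ← Finset.sum_mul, ← Finset.sum_mul, hs]; ring
    _ ≤ _ := by nlinarith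

lemma Lsum_eq {p D : ℝ} (hp : 0 < p) (hp1 : p < 1) (hD : 0 ≤ D) (hD1 : D ≤ 1) :
    LsumA1erasure p D =
      ((2 - ((1 - D) * binH p + (1 + D) * binH (2 * p * (1 - p))) : ℝ) : EReal) := by
  unfold LsumA1erasure
  apply le_antisymm
  · apply sInf_le
    have hk : ∀ x : Bool, ∑ v : Fin 3, (fun (x : Bool) (v : Fin 3) => if v = 2 then D else
        if v = (if x then 1 else 0) then 1 - D else 0) x v = 1 := by
      intro x; cases x <;> simp [Fin.sum_univ_three]
    have hk0 : ∀ (x : Bool) (v : Fin 3), 0 ≤ (fun (x : Bool) (v : Fin 3) => if v = 2 then D else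
        if v = (if x then 1 else 0) then 1 - D else 0) x v := by
      intro x v; dsimp only; split_ifs <;> linarith
    refine ⟨3, fun x v => if v = 2 then D else if v = (if x then 1 else 0) then 1 - D else 0,
      hk0, hk, fun _ v => if v = 2 then none else if v = 1 then some true else some false, ?_, ?_⟩
    · have := j1_sum p (fun (x : Bool) (v : Fin 3) => if v = 2 then D else
        if v = (if x then 1 else 0) then 1 - D else 0) (fun u => if u = 2 then 1 else 0)
      have e : ∑ u : Fin 3, (if u = 2 then (1 : ℝ) else 0) *
        (((fun (x : Bool) (v : Fin 3) => if v = 2 then D else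
        if v = (if x then 1 else 0) then 1 - D else 0) false u + (fun (x : Bool) (v : Fin 3) => if v = 2 then D else
        if v = (if x then 1 else 0) then 1 - D else 0) true u) / 2) = D := by
        simp [Fin.sum_univ_three]
      rw [e] at this
      refine le_trans ?_ (le_of_eq (congrArg ENNReal.ofReal this))
      rw [ENNReal.ofReal_sum_of_nonneg]
      · refine Finset.sum_le_sum fun w _ => ?_
        obtain ⟨x1, y1, x2, y2, u⟩ := w
        fin_cases u <;> cases x1 <;> simp [dErase, j1]
      · intro w _
        refine mul_nonneg (j1_nonneg hp hp1 _ hk0 w) ?_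
        split_ifs <;> norm_num
    · have := j1_MI p _ hk
      unfold j1 at this
      rw [this, src_MI hp hp1, Fin.sum_univ_three]
      congr 1
      simp only [Fin.isValue, reduceCtorEq]
      simp
      rw [Fc_symm p 0, Fc_left hp hp1 (by linarith), Fc_diag hp hp1 hD]
      ring
  · apply le_sInf
    rintro L ⟨n, κ, h0, h, g, hg, rfl⟩
    have := j1_MI p κ h
    have l := lower hp hp1 hD κ h0 h g hg
    unfold j1 at this
    rw [this, src_MI hp hp1, EReal.coe_le_coe_iff]
    linarith

lemma xl_ge (k : ℕ) {v : ℝ} (hv : 0 ≤ v) :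
    -(k * v) + (v - 1 / 2 ^ k) * (Real.log 2)⁻¹ ≤ xl v := by
  have hl : 0 < Real.log 2 := Real.log_pos (by norm_num)
  have := gibbs1 hv (c := 1 / 2 ^ k) (by positivity)
  rw [one_div, Real.log_inv, Real.log_pow] at this
  have h2 := mul_le_mul_of_nonneg_right this (inv_nonneg.mpr hl.le)
  unfold xl Real.logb
  have e : (v * -(k * Real.log 2) + v - (2 ^ k)⁻¹) * (Real.log 2)⁻¹ =
    -(k * v) + (v - 1 / 2 ^ k) * (Real.log 2)⁻¹ := by field_simp; ring
  rw [e] at h2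
  rw [← mul_div_assoc, div_eq_mul_inv]
  exact h2

lemma xl_le (k : ℕ) {v : ℝ} (hv : 0 < v) :
    xl v ≤ -(k * v) + v * (v * 2 ^ k - 1) * (Real.log 2)⁻¹ := by
  have hl : 0 < Real.log 2 := Real.log_pos (by norm_num)
  have := Real.log_le_sub_one_of_pos (x := v * 2 ^ k) (by positivity)
  rw [Real.log_mul hv.ne' (by positivity), Real.log_pow] at this
  have h2 := mul_le_mul_of_nonneg_right (mul_le_mul_of_nonneg_left this hv.le)
    (inv_nonneg.mpr hl.le)
  unfold xl Real.logb
  have e : v * (Real.log v + k * Real.log 2) * (Real.log 2)⁻¹ =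
    v * (Real.log v / Real.log 2) + k * v := by field_simp
  rw [e] at h2
  linarith

lemma D1_val : (∑ w : Bool × Bool × Bool × Bool × Bool × Option Bool,
        ENNReal.ofReal (joint2round 0.03 0.35 0.55 w) * dErase w.1 w.2.2.2.2.2).toReal
        = 0.71155 := by
  have e : ∀ w : Bool × Bool × Bool × Bool × Bool × Option Bool,
      ENNReal.ofReal (joint2round 0.03 0.35 0.55 w) * dErase w.1 w.2.2.2.2.2 =
      ENNReal.ofReal (if w.2.2.2.2.2 = none then joint2round 0.03 0.35 0.55 w else 0) := by
    rintro ⟨x1, y1, x2, y2, u1, _ | u2⟩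
    · simp [dErase]
    · cases x1 <;> cases u1 <;> cases u2 <;> simp [dErase, joint2round, κ2Table]
  simp only [e]
  rw [← ENNReal.ofReal_sum_of_nonneg, ENNReal.toReal_ofReal]
  · simp [Fintype.sum_prod_type, Fintype.sum_option, joint2round, κ2Table, κ1BSC, srcDSBS]
    norm_num
  · refine Finset.sum_nonneg ?_
    rintro ⟨x1, y1, x2, y2, u1, u2⟩ -
    split_ifs with h
    · dsimp only at h; subst h
      have := src_pos (p := 0.03) (by norm_num) (by norm_num) (x1, y1, x2, y2)
      unfold joint2round κ1BSC
      refine mul_nonneg (mul_nonneg this.le ?_) ?_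
      · split_ifs <;> norm_num
      · cases x1 <;> cases u1 <;> simp [κ2Table] <;> norm_num
    · rfl
  · rintro ⟨x1, y1, x2, y2, u1, u2⟩ -
    split_ifs with h
    · dsimp only at h; subst h
      have := src_pos (p := 0.03) (by norm_num) (by norm_num) (x1, y1, x2, y2)
      unfold joint2round κ1BSC
      refine mul_nonneg (mul_nonneg this.le ?_) ?_
      · split_ifs <;> norm_num
      · cases x1 <;> cases u1 <;> simp [κ2Table] <;> norm_num
    · rfl

lemma v3 (y : Bool) : pushf (joint2round 0.03 0.35 0.55) (fun w => w.2.2.2.1) y = 1 / 2 := by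
  cases y <;> simp [pushf, Fintype.sum_prod_type, Fintype.sum_option, joint2round, κ2Table, κ1BSC, srcDSBS] <;>
    norm_num

lemma v40 (u x : Bool) : pushf (joint2round 0.03 0.35 0.55) (fun w => (w.2.2.2.2.1, w.1)) (u, x)
    = if u = x then 0.3205 else 0.1795 := by
  cases u <;> cases x <;> simp [pushf, Fintype.sum_prod_type, Fintype.sum_option, joint2round, κ2Table, κ1BSC, srcDSBS] <;>
    norm_num

lemma v42 (u x : Bool) : pushf (joint2round 0.03 0.35 0.55) (fun w => (w.2.2.2.2.1, w.2.2.1)) (u, x)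
    = if u = x then 0.325 else 0.175 := by
  cases u <;> cases x <;> simp [pushf, Fintype.sum_prod_type, Fintype.sum_option, joint2round, κ2Table, κ1BSC, srcDSBS] <;>
    norm_num

lemma v340 (y u x : Bool) :
    pushf (joint2round 0.03 0.35 0.55) (fun w => (w.2.2.2.1, (w.2.2.2.2.1, w.1))) (y, (u, x))
    = if y = x then (if u = x then 0.30595 else 0.16495) else 0.01455 := by
  cases y <;> cases u <;> cases x <;> simp [pushf, Fintype.sum_prod_type, Fintype.sum_option, joint2round, κ2Table, κ1BSC, srcDSBS] <;>
    norm_num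

lemma v142 (y u x : Bool) :
    pushf (joint2round 0.03 0.35 0.55) (fun w => (w.2.1, (w.2.2.2.2.1, w.2.2.1))) (y, (u, x))
    = if y = x then (if u = x then 0.306085 else 0.164815) else
        (if u = x then 0.018915 else 0.010185) := by
  cases y <;> cases u <;> cases x <;> simp [pushf, Fintype.sum_prod_type, Fintype.sum_option, joint2round, κ2Table, κ1BSC, srcDSBS] <;>
    norm_num

lemma v542n (u x : Bool) :
    pushf (joint2round 0.03 0.35 0.55) (fun w => (w.2.2.2.2.2, (w.2.2.2.2.1, w.2.2.1))) (none, (u, x))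
    = if u = x then 0.1831375 else 0.1726375 := by
  cases u <;> cases x <;> simp [pushf, Fintype.sum_prod_type, Fintype.sum_option, joint2round, κ2Table, κ1BSC, srcDSBS] <;>
    norm_num

lemma v542s (c u x : Bool) :
    pushf (joint2round 0.03 0.35 0.55) (fun w => (w.2.2.2.2.2, (w.2.2.2.2.1, w.2.2.1))) (some c, (u, x))
    = if c = u then (if u = x then 0.1418625 else 0.0023625) else 0 := by
  cases c <;> cases u <;> cases x <;> simp [pushf, Fintype.sum_prod_type, Fintype.sum_option, joint2round, κ2Table, κ1BSC, srcDSBS] <;>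
    norm_num

lemma v1542n (y u x : Bool) :
    pushf (joint2round 0.03 0.35 0.55) (fun w => ((w.2.1, w.2.2.2.2.2), (w.2.2.2.2.1, w.2.2.1))) ((y, none), (u, x))
    = if y = x then (if u = x then 0.168478375 else 0.164744125) else
        (if u = x then 0.014659125 else 0.007893375) := by
  cases y <;> cases u <;> cases x <;> simp [pushf, Fintype.sum_prod_type, Fintype.sum_option, joint2round, κ2Table, κ1BSC, srcDSBS] <;>
    norm_num

lemma v1542s (y c u x : Bool) :
    pushf (joint2round 0.03 0.35 0.55) (fun w => ((w.2.1, w.2.2.2.2.2), (w.2.2.2.2.1, w.2.2.1))) ((y, some c), (u, x))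
    = if c = u then (if u = x then (if y = x then 0.137606625 else 0.004255875) else
      (if y = x then 0.000070875 else 0.002291625)) else 0 := by
  cases y <;> cases c <;> cases u <;> cases x <;> simp [pushf, Fintype.sum_prod_type, Fintype.sum_option, joint2round, κ2Table, κ1BSC, srcDSBS] <;>
    norm_num

lemma two_round :
    MIrv2 (joint2round 0.03 0.35 0.55) (fun w => w.2.2.2.1) (fun w => (w.2.2.2.2.1, w.1)) +
        condMIrv2 (joint2round 0.03 0.35 0.55) (fun w => w.2.1) (fun w => w.2.2.2.2.2)
          (fun w => (w.2.2.2.2.1, w.2.2.1)) <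
     2 - ((1 - 0.71155) * binH 0.03 + (1 + 0.71155) * binH (2 * 0.03 * (1 - 0.03))) := by
  have hb : ∀ t, binH t = - xl t - xl (1 - t) := fun t => by unfold binH xl; ring
  unfold MIrv2 condMIrv2 condEntRV2 HRV2
  simp only [Hent2_eq, Fintype.sum_prod_type, Fintype.sum_option, Fintype.sum_bool, v3, v40, v42,
    v340, v142, v542n, v542s, v1542n, v1542s, hb]
  have e1 : (1 : ℝ) - 0.03 = 0.97 := by norm_num
  have e2 : (2 : ℝ) * 0.03 * 0.97 = 0.0582 := by norm_num
  have e3 : (1 : ℝ) - 0.0582 = 0.9418 := by norm_num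
  rw [e1, e2, e3]
  simp only [if_true, Bool.false_eq_true, Bool.true_eq_false, if_false, xl_zero, xl_half]
  have t1 : (Real.log 2)⁻¹ < 1.4427 := by
    rw [inv_lt_comm₀ (Real.log_pos (by norm_num)) (by norm_num)]
    have := Real.log_two_gt_d9
    norm_num at this ⊢
    linarith
  have t2 : 1.4426 < (Real.log 2)⁻¹ := by
    rw [lt_inv_comm₀ (by norm_num) (Real.log_pos (by norm_num))]
    have := Real.log_two_lt_d9
    norm_num at this ⊢
    linarith
  have l0 := xl_ge 2 (v := 0.3205) (by norm_num)
  have l1 := xl_ge 3 (v := 0.1795) (by norm_num)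
  have l2 := xl_ge 2 (v := 0.306085) (by norm_num)
  have l3 := xl_ge 3 (v := 0.164815) (by norm_num)
  have l4 := xl_ge 6 (v := 0.018915) (by norm_num)
  have l5 := xl_ge 7 (v := 0.010185) (by norm_num)
  have l6 := xl_ge 2 (v := 0.1831375) (by norm_num)
  have l7 := xl_ge 3 (v := 0.1726375) (by norm_num)
  have l8 := xl_ge 3 (v := 0.1418625) (by norm_num)
  have l9 := xl_ge 9 (v := 0.0023625) (by norm_num)
  have l10 := xl_ge 5 (v := 0.03) (by norm_num)
  have l11 := xl_ge 0 (v := 0.97) (by norm_num)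
  have l12 := xl_ge 4 (v := 0.0582) (by norm_num)
  have l13 := xl_ge 0 (v := 0.9418) (by norm_num)
  have u0 := xl_le 2 (v := 0.325) (by norm_num)
  have u1 := xl_le 2 (v := 0.175) (by norm_num)
  have u2 := xl_le 2 (v := 0.30595) (by norm_num)
  have u3 := xl_le 3 (v := 0.16495) (by norm_num)
  have u4 := xl_le 6 (v := 0.01455) (by norm_num)
  have u5 := xl_le 3 (v := 0.168478375) (by norm_num)
  have u6 := xl_le 3 (v := 0.164744125) (by norm_num)
  have u7 := xl_le 6 (v := 0.014659125) (by norm_num)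
  have u8 := xl_le 7 (v := 0.007893375) (by norm_num)
  have u9 := xl_le 3 (v := 0.137606625) (by norm_num)
  have u10 := xl_le 8 (v := 0.004255875) (by norm_num)
  have u11 := xl_le 14 (v := 0.000070875) (by norm_num)
  have u12 := xl_le 9 (v := 0.002291625) (by norm_num)
  generalize (Real.log 2)⁻¹ = t at *
  push_cast at *
  generalize xl 0.3205 = z0 at *
  generalize xl 0.1795 = z1 at *
  generalize xl 0.306085 = z2 at *
  generalize xl 0.164815 = z3 at *
  generalize xl 0.018915 = z4 at *
  generalize xl 0.010185 = z5 at *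
  generalize xl 0.1831375 = z6 at *
  generalize xl 0.1726375 = z7 at *
  generalize xl 0.1418625 = z8 at *
  generalize xl 0.0023625 = z9 at *
  generalize xl 0.03 = z10 at *
  generalize xl 0.97 = z11 at *
  generalize xl 0.0582 = z12 at *
  generalize xl 0.9418 = z13 at *
  generalize xl 0.325 = z14 at *
  generalize xl 0.175 = z15 at *
  generalize xl 0.30595 = z16 at *
  generalize xl 0.16495 = z17 at *
  generalize xl 0.01455 = z18 at *
  generalize xl 0.168478375 = z19 at *
  generalize xl 0.164744125 = z20 at *
  generalize xl 0.014659125 = z21 at *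
  generalize xl 0.007893375 = z22 at *
  generalize xl 0.137606625 = z23 at *
  generalize xl 0.004255875 = z24 at *
  generalize xl 0.000070875 = z25 at *
  generalize xl 0.002291625 = z26 at *
  norm_num1 at *
  linarith

/-- **Interaction strictly reduces leakage in the binary erasure example.**
For `p = 0.03`, the two-round mechanism initiated at agent B with `α = 0.35`,
`β = 0.55` and `X̂1 = U2` achieves, at its own expected erasure distortion `D1`,
a sum leakage `I(Y2; U1, X1) + I(Y1; U2 | U1, X2)` strictly smaller than the optimal
one-round sum leakage `L^A_{sum,1}(D1, 0) = 2 - [(1-D1)H(p) + (1+D1)H(2p(1-p))]`. -/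
theorem interaction_reduces_leakage_erasure :
    ∀ p α β : ℝ, p = 0.03 → α = 0.35 → β = 0.55 →
    ∀ D1 : ℝ,
      D1 = (∑ w : Bool × Bool × Bool × Bool × Bool × Option Bool,
        ENNReal.ofReal (joint2round p α β w) * dErase w.1 w.2.2.2.2.2).toReal →
      -- the achieved two-round sum leakage is strictly smaller than the optimal
      -- one-round sum leakage at the same distortion
      ((MIrv2 (joint2round p α β)
          (fun w => w.2.2.2.1) (fun w => (w.2.2.2.2.1, w.1)) +
        condMIrv2 (joint2round p α β)
          (fun w => w.2.1) (fun w => w.2.2.2.2.2)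
          (fun w => (w.2.2.2.2.1, w.2.2.1)) : ℝ) : EReal) <
        LsumA1erasure p D1 ∧
      LsumA1erasure p D1 =
        ((2 - ((1 - D1) * binH p + (1 + D1) * binH (2 * p * (1 - p))) : ℝ) : EReal) := by
  rintro p α β rfl rfl rfl D1 hD
  rw [D1_val] at hD
  subst hD
  have h := Lsum_eq (p := 0.03) (D := 0.71155) (by norm_num) (by norm_num) (by norm_num) (by norm_num)
  refine ⟨?_, h⟩
  rw [h, EReal.coe_lt_coe_iff]
  exact two_round

end
end
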